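/- Let μ be a Borel probability measure on [0,∞) and let c > 0 be a real constant such that c·μ((0,∞)) > 1. Then there exists a unique γ ∈ [0,∞) satisfying 1 = c·∫_{[0,∞)} (γτ)/(1 + γτ) dμ(τ), and this γ is strictly positive. -/

import Mathlib

open MeasureTheory Set

lemma aux_bd {g t : ℝ} (hg : 0 ≤ g) (ht : 0 ≤ t) : ‖(g * t) / (1 + g * t)‖ ≤ 1 := by
  have h : 0 ≤ g * t := mul_nonneg hg ht
  rw [Real.norm_of_nonneg (by positivity)]
  exact div_le_one_of_le₀ (by linarith) (by linarith)

lemma aux_meas (μ : Measure ℝ) (g : ℝ) :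
    AEStronglyMeasurable (fun t : ℝ => (g * t) / (1 + g * t)) μ := by
  apply Measurable.aestronglyMeasurable
  fun_prop

lemma aux_int (μ : Measure ℝ) [IsProbabilityMeasure μ] (hae : ∀ᵐ t ∂μ, 0 ≤ t) {g : ℝ}
    (hg : 0 ≤ g) : Integrable (fun t : ℝ => (g * t) / (1 + g * t)) μ := by
  refine Integrable.of_bound (aux_meas μ g) 1 ?_
  filter_upwards [hae] with t ht using aux_bd hg ht

lemma aux_sub {a b t : ℝ} (ha : 0 ≤ a) (hb : 0 ≤ b) (ht : 0 ≤ t) :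
    (b * t) / (1 + b * t) - (a * t) / (1 + a * t)
      = (b - a) * t / ((1 + b * t) * (1 + a * t)) := by
  have h1 : 0 < 1 + b * t := by positivity
  have h2 : 0 < 1 + a * t := by positivity
  field_simp
  ring

lemma aux_lt (μ : Measure ℝ) [IsProbabilityMeasure μ] (hae : ∀ᵐ t ∂μ, 0 ≤ t)
    (hpos : μ (Ioi 0) ≠ 0) {a b : ℝ} (ha : 0 ≤ a) (hab : a < b) :
    ∫ t, (a * t) / (1 + a * t) ∂μ ≠ ∫ t, (b * t) / (1 + b * t) ∂μ := by
  intro h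
  have hb : 0 ≤ b := ha.trans hab.le
  have h0 : ∫ t, ((b * t) / (1 + b * t) - (a * t) / (1 + a * t)) ∂μ = 0 := by
    rw [integral_sub (aux_int μ hae hb) (aux_int μ hae ha), h, sub_self]
  have hi : Integrable (fun t : ℝ => (b * t) / (1 + b * t) - (a * t) / (1 + a * t)) μ :=
    (aux_int μ hae hb).sub (aux_int μ hae ha)
  rw [integral_eq_zero_iff_of_nonneg_ae ?_ hi] at h0
  · apply hpos
    have : ∀ᵐ t ∂μ, ¬ (t ∈ Ioi (0:ℝ)) := by
      filter_upwards [h0, hae] with t h1 ht hlt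
      have hlt' : 0 < t := hlt
      simp only [Pi.zero_apply] at h1
      rw [aux_sub ha hb ht] at h1
      have : 0 < b - a := sub_pos.2 hab
      have : 0 < (b - a) * t / ((1 + b * t) * (1 + a * t)) := by positivity
      linarith
    simpa using measure_eq_zero_iff_ae_notMem.2 this
  · filter_upwards [hae] with t ht
    simp only [Pi.zero_apply]
    rw [aux_sub ha hb ht]
    have : 0 < b - a := sub_pos.2 hab
    positivity

lemma aux_cont (μ : Measure ℝ) [IsProbabilityMeasure μ] (hae : ∀ᵐ t ∂μ, 0 ≤ t) :
    ContinuousOn (fun g : ℝ => ∫ t, (g * t) / (1 + g * t) ∂μ) (Ici 0) := by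
  refine continuousOn_of_dominated (bound := fun _ => 1) (fun g _ => aux_meas μ g) ?_
    (integrable_const _) ?_
  · intro g hg
    filter_upwards [hae] with t ht using aux_bd hg ht
  · filter_upwards [hae] with t ht
    refine ContinuousOn.div (by fun_prop) (by fun_prop) ?_
    intro g hg
    have : 0 ≤ g * t := mul_nonneg hg ht
    positivity

lemma aux_lim (μ : Measure ℝ) [IsProbabilityMeasure μ] (hae : ∀ᵐ t ∂μ, 0 ≤ t) :
    Filter.Tendsto (fun g : ℝ => ∫ t, (g * t) / (1 + g * t) ∂μ) Filter.atTop
      (nhds (μ (Ioi 0)).toReal) := by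
  have e : (μ (Ioi 0)).toReal = ∫ t, (Ioi (0:ℝ)).indicator (fun _ => (1:ℝ)) t ∂μ := by
    rw [integral_indicator measurableSet_Ioi]
    simp [Measure.real]
  rw [e]
  refine tendsto_integral_filter_of_dominated_convergence (fun _ => 1)
    (Filter.Eventually.of_forall fun g => aux_meas μ g) ?_ (integrable_const _) ?_
  · filter_upwards [Filter.eventually_ge_atTop 0] with g hg
    filter_upwards [hae] with t ht using aux_bd hg ht
  · filter_upwards [hae] with t ht
    rcases ht.eq_or_lt with rfl | ht
    · simp
    · rw [indicator_of_mem (show t ∈ Ioi (0:ℝ) from ht)]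
      have h1 : Filter.Tendsto (fun g : ℝ => 1 - (1 + g * t)⁻¹) Filter.atTop (nhds (1 - 0)) := by
        refine tendsto_const_nhds.sub (Filter.Tendsto.comp tendsto_inv_atTop_zero ?_)
        exact Filter.tendsto_atTop_add_const_left _ _ (Filter.tendsto_id.atTop_mul_const ht)
      rw [sub_zero] at h1
      refine h1.congr' ?_
      filter_upwards [Filter.eventually_ge_atTop 0] with g hg
      have : 0 < 1 + g * t := by positivity
      field_simp
      ring

/-- Let `μ` be a Borel probability measure on `[0,∞)` (modeled as a
probability measure on `ℝ` giving zero mass to `(-∞,0)`) and let `c > 0` be a real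
constant such that `c · μ((0,∞)) > 1`.  Then there exists a unique `γ ∈ [0,∞)`
satisfying `1 = c · ∫ (γτ)/(1 + γτ) dμ(τ)`, and this `γ` is strictly positive. -/
theorem stmt0 (μ : Measure ℝ) [IsProbabilityMeasure μ]
    (hsupp : μ (Iio 0) = 0) (c : ℝ) (hc : 0 < c)
    (hmass : 1 < c * (μ (Ioi 0)).toReal) :
    ∃ γ : ℝ, 0 < γ ∧ 1 = c * ∫ τ, (γ * τ) / (1 + γ * τ) ∂μ ∧
      ∀ γ' : ℝ, 0 ≤ γ' → 1 = c * ∫ τ, (γ' * τ) / (1 + γ' * τ) ∂μ → γ' = γ := by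
  have hae : ∀ᵐ t ∂μ, 0 ≤ t := by
    have := measure_eq_zero_iff_ae_notMem.1 hsupp
    filter_upwards [this] with t ht
    simpa using ht
  have hpos : μ (Ioi 0) ≠ 0 := by
    intro h
    rw [h] at hmass
    norm_num at hmass
  have hlim := (aux_lim μ hae).const_mul c
  obtain ⟨b, hb1, hb0⟩ := ((hlim.eventually (lt_mem_nhds hmass)).and
    (Filter.eventually_ge_atTop 0)).exists
  have hc' : ContinuousOn (fun g : ℝ => c * ∫ t, (g * t) / (1 + g * t) ∂μ) (Icc 0 b) :=
    continuousOn_const.mul ((aux_cont μ hae).mono Icc_subset_Ici_self)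
  obtain ⟨γ, hγ, hγ1⟩ := intermediate_value_Icc hb0 hc'
    (show (1:ℝ) ∈ Icc _ _ from ⟨by simp, hb1.le⟩)
  simp only at hγ1
  have hγ0 : 0 < γ := by
    rcases hγ.1.eq_or_lt with h | h
    · rw [← h] at hγ1
      simp at hγ1
    · exact h
  refine ⟨γ, hγ0, hγ1.symm, fun g hg h1 => ?_⟩
  have heq := mul_left_cancel₀ hc.ne' (h1.symm.trans hγ1.symm)
  rcases lt_trichotomy g γ with h | h | h
  · exact absurd heq (aux_lt μ hae hpos hg h)
  · exact h
  · exact absurd heq.symm (aux_lt μ hae hpos hγ0.le h)
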